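/- Let p, q ≥ 1, let N ∈ ℝ^{p×q}, let Σ ∈ ℝ^{q×q} and Σ_w ∈ ℝ^{p×p} be positive definite, let μ_w ∈ ℝ^p, let γ ∈ (0,1), ε > 0 and 0 < δ < 1/2. Let ν := N(0, Σ) on ℝ^q, and for U ∈ ℝ^q let μ_U := N(N U + μ_w, Σ_w) on ℝ^p. Suppose that for every pair U, U' ∈ ℝ^q with |U − U'|_K ≤ 1, where K := Σ^{−1}/c(γ, q)², and every Borel set S ⊆ ℝ^p it holds that μ_U(S) ≤ e^ε · μ_{U'}(S) + δ. Then there exists a Borel set E ⊆ ℝ^q × ℝ^q with (ν ⊗ ν)(E) ≥ γ such that for every (U, U') ∈ E and every Borel set S ⊆ ℝ^p it holds that μ_U(S) ≤ e^ε · μ_{U'}(S) + δ. (Corollary 1: (K, ε, δ)-differential privacy with K = Σ^{−1}/c(γ,q)² implies (ν, γ, ε, δ)-Bayesian differential privacy.) -/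

import Mathlib

open MeasureTheory Matrix Real

/-- Gaussian density on `Fin n → ℝ` with mean `m` and covariance `S`. -/
noncomputable def gaussianPdf {n : ℕ} (m : Fin n → ℝ) (S : Matrix (Fin n) (Fin n) ℝ)
    (x : Fin n → ℝ) : ℝ :=
  (2 * π) ^ (-(n : ℝ) / 2) * S.det ^ (-(1 : ℝ) / 2) *
    Real.exp (-(1 / 2) * ((x - m) ⬝ᵥ (S⁻¹ *ᵥ (x - m))))

/-- Gaussian measure `N(m, S)` on `Fin n → ℝ`. -/
noncomputable def gaussianMeasure {n : ℕ} (m : Fin n → ℝ) (S : Matrix (Fin n) (Fin n) ℝ) :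
    Measure (Fin n → ℝ) :=
  volume.withDensity fun x => ENNReal.ofReal (gaussianPdf m S x)

/-- The Q-function `Q(c) = (1/√(2π)) ∫_c^∞ e^{-v²/2} dv`. -/
noncomputable def Qfun (c : ℝ) : ℝ :=
  (1 / Real.sqrt (2 * π)) * ∫ v in Set.Ioi c, Real.exp (-(v ^ 2) / 2)

/-- Inverse of the Q-function. -/
noncomputable def Qinv (δ : ℝ) : ℝ := Function.invFun Qfun δ

/-- `R(ε, δ) = (Q⁻¹(δ) + √((Q⁻¹(δ))² + 2ε)) / (2ε)`. -/
noncomputable def Rfun (ε δ : ℝ) : ℝ :=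
  (Qinv δ + Real.sqrt ((Qinv δ) ^ 2 + 2 * ε)) / (2 * ε)

/-- Weighted norm `|x|_A = (xᵀ A x)^{1/2}`. -/
noncomputable def wnorm {n : ℕ} (A : Matrix (Fin n) (Fin n) ℝ) (x : Fin n → ℝ) : ℝ :=
  Real.sqrt (x ⬝ᵥ (A *ᵥ x))

/-- Largest (real) eigenvalue of a matrix: supremum of its real spectrum. -/
noncomputable def lambdaMax {n : ℕ} (M : Matrix (Fin n) (Fin n) ℝ) : ℝ :=
  sSup (spectrum ℝ M)

/-- Smallest (real) eigenvalue of a matrix: infimum of its real spectrum. -/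
noncomputable def lambdaMin {n : ℕ} (M : Matrix (Fin n) (Fin n) ℝ) : ℝ :=
  sInf (spectrum ℝ M)

/-- χ² probability density with `k` degrees of freedom. -/
noncomputable def chi2pdf (k : ℕ) (z : ℝ) : ℝ :=
  z ^ ((k : ℝ) / 2 - 1) * Real.exp (-z / 2) / (2 ^ ((k : ℝ) / 2) * Real.Gamma ((k : ℝ) / 2))

open scoped MatrixOrder ENNReal

section GaussianQuadraticForm

variable {n : ℕ} {S : Matrix (Fin n) (Fin n) ℝ}

/-- A quadratic form attached to a positive definite matrix has the volume distribution of the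
squared Euclidean norm, scaled by the square root of the determinant. -/
lemma lintegral_comp_inv_quadForm (hS : S.PosDef) {f : ℝ → ℝ≥0∞} (hf : Measurable f) :
    ∫⁻ x, f (x ⬝ᵥ (S⁻¹ *ᵥ x)) =
      ENNReal.ofReal (√S.det) * ∫⁻ y : EuclideanSpace ℝ (Fin n), f (‖y‖ ^ 2) := by
  obtain ⟨B, hB⟩ := CStarAlgebra.nonneg_iff_eq_star_mul_self.mp hS.inv.posSemidef.nonneg
  have hdet : S.det⁻¹ = B.det ^ 2 := by
    have h := congrArg Matrix.det hB
    rw [det_nonsing_inv, Ring.inverse_eq_inv', star_eq_conjTranspose, det_mul,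
      det_conjTranspose] at h
    rw [h, star_trivial, sq]
  have hB0 : B.det ≠ 0 := by
    intro h
    exact hS.det_pos.ne' (by simpa [h] using hdet)
  have hQ (x : Fin n → ℝ) : x ⬝ᵥ (S⁻¹ *ᵥ x) = (toLin' B x) ⬝ᵥ (toLin' B x) := by
    rw [hB, ← mulVec_mulVec, star_eq_conjTranspose, dotProduct_mulVec, vecMul_conjTranspose]
    simp
  have hsqrt : |B.det⁻¹| = √S.det := by
    rw [← inv_inv S.det, hdet, Real.sqrt_inv, Real.sqrt_sq_eq_abs, abs_inv]
  have hg : Measurable fun y : Fin n → ℝ => f (y ⬝ᵥ y) := by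
    unfold dotProduct
    fun_prop
  simp_rw [hQ]
  rw [← lintegral_map (μ := volume) hg (toLin' B).continuous_of_finiteDimensional.measurable,
    Real.map_matrix_volume_pi_eq_smul_volume_pi hB0, lintegral_smul_measure, hsqrt, smul_eq_mul,
    ← (PiLp.volume_preserving_ofLp (Fin n)).lintegral_comp hg]
  congr 2 with y
  rw [EuclideanSpace.real_norm_sq_eq]
  simp [dotProduct, sq]

lemma lintegral_exp_neg_inv_quadForm (hS : S.PosDef) :
    ∫⁻ x, ENNReal.ofReal (Real.exp (-(x ⬝ᵥ (S⁻¹ *ᵥ x)))) =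
      ENNReal.ofReal (√S.det * π ^ ((n : ℝ) / 2)) := by
  rw [lintegral_comp_inv_quadForm hS (f := fun t => ENNReal.ofReal (Real.exp (-t))) (by fun_prop),
    ENNReal.ofReal_mul (Real.sqrt_nonneg _)]
  have h := GaussianFourier.integral_rexp_neg_mul_sq_norm (V := EuclideanSpace ℝ (Fin n)) one_pos
  simp only [neg_mul, one_mul, div_one, finrank_euclideanSpace, Fintype.card_fin] at h
  rw [← h, ofReal_integral_eq_lintegral_ofReal]
  · exact Integrable.of_integral_ne_zero (by rw [h]; positivity)
  · exact .of_forall fun _ => (Real.exp_pos _).le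

lemma setIntegral_rpow_mul_exp_eq_chi2pdf (hn : 1 ≤ n) {c : ℝ} (hc : 0 < c) :
    ∫ r in Set.Ioc 0 c, r ^ (n - 1) * Real.exp (-(r ^ 2) / 4) =
      2 ^ ((n : ℝ) - 1) * Real.Gamma ((n : ℝ) / 2) *
        ∫ x in (0 : ℝ)..(c ^ 2 / 2), chi2pdf n x := by
  have himage : (fun r : ℝ => r ^ 2 / 2) '' Set.Ioc 0 c = Set.Ioc 0 (c ^ 2 / 2) := by
    ext z
    constructor
    · rintro ⟨r, ⟨h0, h1⟩, rfl⟩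
      exact ⟨by positivity, by dsimp only; gcongr⟩
    · rintro ⟨h0, h1⟩
      refine ⟨√(2 * z), ⟨by positivity, Real.sqrt_le_iff.mpr ⟨hc.le, by linarith⟩⟩, ?_⟩
      dsimp only
      rw [Real.sq_sqrt (by positivity)]
      ring
  have hinj : Set.InjOn (fun r : ℝ => r ^ 2 / 2) (Set.Ioc 0 c) := by
    intro a ha b hb hab
    exact (sq_eq_sq₀ ha.1.le hb.1.le).mp (by simpa using hab)
  rw [intervalIntegral.integral_of_le (by positivity), ← himage,
    integral_image_eq_integral_abs_deriv_smul (f' := fun r => r) measurableSet_Ioc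
      (fun r _ => by simpa using ((hasDerivAt_pow 2 r).div_const 2).hasDerivWithinAt) hinj,
    ← integral_const_mul]
  refine setIntegral_congr_fun measurableSet_Ioc fun r hr => ?_
  have hr : 0 < r := hr.1
  have hΓ : 0 < Real.Gamma ((n : ℝ) / 2) := Real.Gamma_pos_of_pos (by positivity)
  have h1 : (r ^ 2 / 2) ^ ((n : ℝ) / 2 - 1) =
      r ^ ((n : ℝ) - 2) / 2 ^ ((n : ℝ) / 2 - 1) := by
    rw [Real.div_rpow (by positivity) (by positivity), ← Real.rpow_natCast, ← Real.rpow_mul hr.le]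
    congr 2
    push_cast
    ring
  have h2 : r ^ (n - 1) = r * r ^ ((n : ℝ) - 2) := by
    nth_rw 2 [← Real.rpow_one r]
    rw [← Real.rpow_natCast, Nat.cast_sub hn, ← Real.rpow_add hr]
    congr 1
    push_cast
    ring
  have h3 : (2 : ℝ) ^ ((n : ℝ) - 1) = 2 ^ ((n : ℝ) / 2 - 1) * 2 ^ ((n : ℝ) / 2) := by
    rw [← Real.rpow_add two_pos]
    congr 1
    ring
  simp only [chi2pdf, abs_of_pos hr, smul_eq_mul]
  rw [h1, h2, h3, show -(r ^ 2 / 2) / 2 = -(r ^ 2) / 4 by ring]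
  field_simp

lemma lintegral_closedBall_exp_neg_sq_norm (hn : 1 ≤ n) {c : ℝ} (hc : 0 < c) :
    ∫⁻ y : EuclideanSpace ℝ (Fin n),
        (Set.Iic (c ^ 2)).indicator (fun t => ENNReal.ofReal (Real.exp (-t / 4))) (‖y‖ ^ 2) =
      ENNReal.ofReal ((4 * π) ^ ((n : ℝ) / 2) * ∫ x in (0 : ℝ)..(c ^ 2 / 2), chi2pdf n x) := by
  have : Nonempty (Fin n) := ⟨⟨0, hn⟩⟩
  set f : ℝ → ℝ := (Set.Iic c).indicator fun r => Real.exp (-(r ^ 2) / 4) with hf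
  have hfnn (r : ℝ) : 0 ≤ f r := Set.indicator_nonneg (fun _ _ => (Real.exp_pos _).le) r
  have hfeq (y : EuclideanSpace ℝ (Fin n)) :
      (Set.Iic (c ^ 2)).indicator (fun t => ENNReal.ofReal (Real.exp (-t / 4))) (‖y‖ ^ 2) =
        ENNReal.ofReal (f ‖y‖) := by
    have : ‖y‖ ^ 2 ≤ c ^ 2 ↔ ‖y‖ ≤ c := sq_le_sq₀ (norm_nonneg y) hc.le
    by_cases h : ‖y‖ ≤ c <;> simp [hf, Set.indicator, this, h]
  have hfm : Measurable f := Measurable.indicator (by fun_prop) measurableSet_Iic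
  have hint : Integrable fun y : EuclideanSpace ℝ (Fin n) => f ‖y‖ := by
    have hball : IntegrableOn (fun _ => (1 : ℝ))
        (Metric.closedBall (0 : EuclideanSpace ℝ (Fin n)) c) :=
      integrableOn_const measure_closedBall_lt_top.ne
    refine (hball.integrable_indicator Metric.isClosed_closedBall.measurableSet).mono'
      (hfm.comp measurable_norm).aestronglyMeasurable (.of_forall fun y => ?_)
    rw [Real.norm_of_nonneg (hfnn _)]
    by_cases h : ‖y‖ ≤ c
    · simp only [hf, Set.indicator, Set.mem_Iic, h, Metric.mem_closedBall, dist_zero_right, if_true]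
      exact Real.exp_le_one_iff.mpr (by nlinarith [sq_nonneg ‖y‖])
    · simp [hf, Set.indicator, h]
  simp_rw [hfeq]
  rw [← ofReal_integral_eq_lintegral_ofReal hint (.of_forall fun _ => hfnn _),
    integral_fun_norm_addHaar, finrank_euclideanSpace, Fintype.card_fin]
  congr 1
  have hradial : ∫ r in Set.Ioi (0 : ℝ), r ^ (n - 1) • f r =
      ∫ r in Set.Ioc 0 c, r ^ (n - 1) * Real.exp (-(r ^ 2) / 4) := by
    rw [← Set.Ioi_inter_Iic, ← setIntegral_indicator measurableSet_Iic]
    refine setIntegral_congr_fun measurableSet_Ioi fun r _ => ?_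
    by_cases h : r ≤ c <;> simp [hf, Set.indicator, h]
  have hn0 : (0 : ℝ) < n := by exact_mod_cast hn
  have hΓ : 0 < Real.Gamma ((n : ℝ) / 2) := Real.Gamma_pos_of_pos (by positivity)
  have hvol : volume.real (Metric.ball (0 : EuclideanSpace ℝ (Fin n)) 1) =
      π ^ ((n : ℝ) / 2) / ((n : ℝ) / 2 * Real.Gamma ((n : ℝ) / 2)) := by
    rw [measureReal_def, EuclideanSpace.volume_ball, Fintype.card_fin, ENNReal.ofReal_one, one_pow,
      one_mul, Real.Gamma_add_one (by positivity), ENNReal.toReal_ofReal (by positivity),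
      Real.sqrt_eq_rpow, ← Real.rpow_natCast, ← Real.rpow_mul Real.pi_pos.le]
    congr 2
    ring
  have h4 : (4 * π) ^ ((n : ℝ) / 2) = 2 * 2 ^ ((n : ℝ) - 1) * π ^ ((n : ℝ) / 2) := by
    rw [Real.mul_rpow (by norm_num) Real.pi_pos.le, show (4 : ℝ) = 2 ^ (2 : ℝ) by norm_num,
      ← Real.rpow_mul two_pos.le, Real.rpow_sub two_pos, Real.rpow_one]
    field_simp
  rw [hradial, setIntegral_rpow_mul_exp_eq_chi2pdf hn hc, hvol, h4]
  simp only [nsmul_eq_mul, smul_eq_mul]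
  field_simp

lemma measurable_inv_quadForm : Measurable fun x : Fin n → ℝ => x ⬝ᵥ (S⁻¹ *ᵥ x) := by
  simp only [dotProduct, mulVec]
  fun_prop

lemma gaussianPdf_add_mul_gaussianPdf (hS : S.PosDef) (u v : Fin n → ℝ) :
    gaussianPdf 0 S (v + u) * gaussianPdf 0 S u =
      ((2 * π) ^ (n : ℝ) * S.det)⁻¹ * Real.exp (-(v ⬝ᵥ (S⁻¹ *ᵥ v)) / 4) *
        Real.exp (-((u + (1 / 2 : ℝ) • v) ⬝ᵥ (S⁻¹ *ᵥ (u + (1 / 2 : ℝ) • v)))) := by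
  have hsymm : u ⬝ᵥ (S⁻¹ *ᵥ v) = v ⬝ᵥ (S⁻¹ *ᵥ u) := by
    have hT : (S⁻¹)ᵀ = S⁻¹ := by
      simpa [conjTranspose_eq_transpose_of_trivial] using hS.inv.isHermitian.eq
    rw [dotProduct_mulVec, ← mulVec_transpose, hT, dotProduct_comm]
  have hconst : ((2 * π) ^ (-(n : ℝ) / 2) * S.det ^ (-(1 : ℝ) / 2)) ^ 2 =
      ((2 * π) ^ (n : ℝ) * S.det)⁻¹ := by
    rw [mul_pow, ← Real.rpow_mul_natCast (by positivity), ← Real.rpow_mul_natCast hS.det_pos.le,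
      mul_inv, ← Real.rpow_neg (by positivity), ← Real.rpow_neg_one S.det]
    congr 2 <;> push_cast <;> ring
  rw [mul_assoc, ← Real.exp_add, ← hconst, gaussianPdf, gaussianPdf, mul_mul_mul_comm,
    ← Real.exp_add, ← sq]
  congr 2
  simp only [sub_zero, mulVec_add, mulVec_smul, dotProduct_add, add_dotProduct, dotProduct_smul,
    smul_dotProduct, smul_eq_mul, hsymm]
  ring

/-- For independent `U, U' ∼ N(0, S)`, the quantity `(U - U')ᵀ S⁻¹ (U - U') / 2` is `χ²`-distributed
with `n` degrees of freedom. -/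
lemma gaussianMeasure_prod_quadForm_sub_le (hS : S.PosDef) (hn : 1 ≤ n) {c : ℝ} (hc : 0 < c) :
    ((gaussianMeasure 0 S).prod (gaussianMeasure 0 S))
        {z | (z.1 - z.2) ⬝ᵥ (S⁻¹ *ᵥ (z.1 - z.2)) ≤ c ^ 2} =
      ENNReal.ofReal (∫ x in (0 : ℝ)..(c ^ 2 / 2), chi2pdf n x) := by
  have hQ := measurable_inv_quadForm (S := S)
  have hpdf : Measurable fun x => ENNReal.ofReal (gaussianPdf 0 S x) := by
    simp only [gaussianPdf, sub_zero]
    fun_prop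
  have hprod : Measurable fun z : (Fin n → ℝ) × (Fin n → ℝ) =>
      ENNReal.ofReal (gaussianPdf 0 S z.1) * ENNReal.ofReal (gaussianPdf 0 S z.2) :=
    (hpdf.comp measurable_fst).mul (hpdf.comp measurable_snd)
  have hpdfnn (x : Fin n → ℝ) : 0 ≤ gaussianPdf 0 S x := by
    have := hS.det_pos
    unfold gaussianPdf
    positivity
  have hE : MeasurableSet {z : (Fin n → ℝ) × (Fin n → ℝ) |
      (z.1 - z.2) ⬝ᵥ (S⁻¹ *ᵥ (z.1 - z.2)) ≤ c ^ 2} :=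
    measurableSet_le (hQ.comp (measurable_fst.sub measurable_snd)) measurable_const
  set K : ℝ := ((2 * π) ^ (n : ℝ) * S.det)⁻¹ with hK
  have hK0 : 0 ≤ K := by have := hS.det_pos; positivity
  set g : ℝ → ℝ≥0∞ := (Set.Iic (c ^ 2)).indicator (fun t => ENNReal.ofReal (Real.exp (-t / 4)))
    with hg
  have hgm : Measurable g := Measurable.indicator (by fun_prop) measurableSet_Iic
  set h : (Fin n → ℝ) → ℝ≥0∞ := fun x => ENNReal.ofReal (Real.exp (-(x ⬝ᵥ (S⁻¹ *ᵥ x)))) with hh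
  have hhm : Measurable h := by fun_prop
  have hpoint (u v : Fin n → ℝ) :
      {z : (Fin n → ℝ) × (Fin n → ℝ) |
          (z.1 - z.2) ⬝ᵥ (S⁻¹ *ᵥ (z.1 - z.2)) ≤ c ^ 2}.indicator
        (fun z => ENNReal.ofReal (gaussianPdf 0 S z.1) * ENNReal.ofReal (gaussianPdf 0 S z.2))
        (v + u, u) =
      ENNReal.ofReal K * g (v ⬝ᵥ (S⁻¹ *ᵥ v)) * h (u + (1 / 2 : ℝ) • v) := by
    by_cases hv : v ⬝ᵥ (S⁻¹ *ᵥ v) ≤ c ^ 2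
    · simp only [hg, hh, Set.indicator, Set.mem_ofPred_eq, Set.mem_Iic, add_sub_cancel_right, hv,
        if_true]
      rw [← ENNReal.ofReal_mul (hpdfnn _), gaussianPdf_add_mul_gaussianPdf hS,
        ENNReal.ofReal_mul (by positivity), ENNReal.ofReal_mul hK0]
    · simp [hg, Set.indicator, hv]
  rw [gaussianMeasure, prod_withDensity hpdf hpdf, withDensity_apply _ hE,
    ← lintegral_indicator hE, lintegral_prod_symm' _ (hprod.indicator hE)]
  calc _ = ∫⁻ u : Fin n → ℝ, ∫⁻ v : Fin n → ℝ,
        ENNReal.ofReal K * g (v ⬝ᵥ (S⁻¹ *ᵥ v)) * h (u + (1 / 2 : ℝ) • v) := by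
        refine lintegral_congr fun u => ?_
        rw [← lintegral_add_right_eq_self _ u]
        exact lintegral_congr fun v => hpoint u v
    _ = ∫⁻ v : Fin n → ℝ, ∫⁻ u : Fin n → ℝ,
        ENNReal.ofReal K * g (v ⬝ᵥ (S⁻¹ *ᵥ v)) * h (u + (1 / 2 : ℝ) • v) :=
        lintegral_lintegral_swap (by fun_prop)
    _ = ∫⁻ v : Fin n → ℝ, ENNReal.ofReal K * g (v ⬝ᵥ (S⁻¹ *ᵥ v)) * ∫⁻ u, h u := by
        refine lintegral_congr fun v => ?_
        rw [lintegral_const_mul _ (by fun_prop), lintegral_add_right_eq_self h]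
    _ = ENNReal.ofReal K * (∫⁻ v : Fin n → ℝ, g (v ⬝ᵥ (S⁻¹ *ᵥ v))) * ∫⁻ u, h u := by
        rw [lintegral_mul_const _ (by fun_prop), lintegral_const_mul _ (by fun_prop)]
    _ = _ := by
        have hdet := hS.det_pos
        rw [lintegral_comp_inv_quadForm hS hgm, lintegral_closedBall_exp_neg_sq_norm hn hc,
          lintegral_exp_neg_inv_quadForm hS, ← ENNReal.ofReal_mul (Real.sqrt_nonneg _),
          ← ENNReal.ofReal_mul hK0, ← ENNReal.ofReal_mul' (by positivity)]
        congr 1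
        have hπ : (4 * π) ^ ((n : ℝ) / 2) * π ^ ((n : ℝ) / 2) = (2 * π) ^ (n : ℝ) := by
          rw [← Real.mul_rpow (by positivity) (by positivity),
            show 4 * π * π = (2 * π) ^ (2 : ℝ) by rw [Real.rpow_two]; ring,
            ← Real.rpow_mul (by positivity)]
          congr 1
          ring
        have hsq := Real.mul_self_sqrt hdet.le
        calc _ = K * ((√S.det * √S.det) * ((4 * π) ^ ((n : ℝ) / 2) * π ^ ((n : ℝ) / 2))) *
              ∫ x in (0 : ℝ)..(c ^ 2 / 2), chi2pdf n x := by ring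
          _ = _ := by
              rw [hsq, hπ, hK]
              field_simp

end GaussianQuadraticForm

/-- **Corollary 1.** `(K, ε, δ)`-differential privacy with adjacency weight
`K = Σ⁻¹ / c(γ, q)²` implies `(ν, γ, ε, δ)`-Bayesian differential privacy, where
`c(γ, q)` is the unique `c > 0` with `∫_0^{c²/2} χ²_q(x) dx = γ` and `ν = N(0, Σ)`. -/
theorem K_DP_implies_BDP
    {p q : ℕ} (hp : 1 ≤ p) (hq : 1 ≤ q)
    (N : Matrix (Fin p) (Fin q) ℝ)
    (Sig : Matrix (Fin q) (Fin q) ℝ) (hSig : Sig.PosDef)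
    (Sw : Matrix (Fin p) (Fin p) ℝ) (hSw : Sw.PosDef)
    (μw : Fin p → ℝ)
    (γ ε δ : ℝ) (hγ0 : 0 < γ) (hγ1 : γ < 1) (hε : 0 < ε) (hδ0 : 0 < δ) (hδ1 : δ < 1 / 2)
    (c : ℝ) (hc : 0 < c) (hcγ : ∫ x in (0:ℝ)..(c ^ 2 / 2), chi2pdf q x = γ)
    (hDP : ∀ U U' : Fin q → ℝ, wnorm ((c ^ 2)⁻¹ • Sig⁻¹) (U - U') ≤ 1 →
      ∀ S : Set (Fin p → ℝ), MeasurableSet S →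
        gaussianMeasure (N *ᵥ U + μw) Sw S
          ≤ ENNReal.ofReal (Real.exp ε) * gaussianMeasure (N *ᵥ U' + μw) Sw S
            + ENNReal.ofReal δ) :
    ∃ E : Set ((Fin q → ℝ) × (Fin q → ℝ)), MeasurableSet E ∧
      ENNReal.ofReal γ ≤ ((gaussianMeasure 0 Sig).prod (gaussianMeasure 0 Sig)) E ∧
      ∀ UU' ∈ E, ∀ S : Set (Fin p → ℝ), MeasurableSet S →
        gaussianMeasure (N *ᵥ UU'.1 + μw) Sw S
          ≤ ENNReal.ofReal (Real.exp ε) * gaussianMeasure (N *ᵥ UU'.2 + μw) Sw S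
            + ENNReal.ofReal δ := by
  refine ⟨{z | (z.1 - z.2) ⬝ᵥ (Sig⁻¹ *ᵥ (z.1 - z.2)) ≤ c ^ 2}, ?_, ?_, ?_⟩
  · exact measurableSet_le
      (measurable_inv_quadForm.comp (measurable_fst.sub measurable_snd)) measurable_const
  · rw [gaussianMeasure_prod_quadForm_sub_le hSig hq hc, hcγ]
  · rintro ⟨U, U'⟩ hU
    refine hDP U U' ?_
    rw [wnorm, Real.sqrt_le_one, smul_mulVec, dotProduct_smul, smul_eq_mul]
    exact inv_mul_le_one_of_le₀ hU (by positivity)
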